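/- Let A be a Banach algebra and η an infinite cardinal. Suppose A contains a weak TI-net {a_α : α ∈ Λ}, indexed injectively by a directed set Λ of true cardinality η, which is an ℓ¹(η)-base in A. Then: (i) there is a bounded linear surjection from A*/W(A) onto ℓ∞(η); (ii) in particular, A is not Arens regular; (iii) if in addition the density character d(A) = η, then A is extremely non-Arens regular. -/

import Mathlib

open Filter Topology
open scoped ENNReal

noncomputable section

universe u

namespace Paper

/-- The density character of a topological space: the smallest cardinality of a dense subset. -/
def densityChar (E : Type u) [TopologicalSpace E] : Cardinal.{u} :=
  ⨅ s : {s : Set E // Dense s}, Cardinal.mk ↥(s.1)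

/-- A subset of a preordered set is cofinal if every element lies below some member of it. -/
def Cofinal {Λ : Type*} [Preorder Λ] (S : Set Λ) : Prop :=
  ∀ ξ : Λ, ∃ α ∈ S, ξ ≤ α

/-- The true cardinality `tr|Λ| = min_{ξ ∈ Λ} |{α : ξ ≺ α}|` of a preordered set. -/
def trueCard (Λ : Type u) [Preorder Λ] : Cardinal.{u} :=
  ⨅ ξ : Λ, Cardinal.mk {α : Λ // ξ < α}

variable (𝕜 : Type u) [RCLike 𝕜]

/-- An `ℓ¹(η)`-base with constant `K` in a normed space: a bounded set of cardinality `η`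
such that `∑ |zₙ| ≤ K ‖∑ zₙ aₙ‖` for all scalars and all finite families of
distinct elements of the set. -/
def IsL1Base {E : Type u} [SeminormedAddCommGroup E] [NormedSpace 𝕜 E]
    (η : Cardinal.{u}) (K : ℝ) (X : Set E) : Prop :=
  Cardinal.mk ↥X = η ∧ (∃ M : ℝ, ∀ x ∈ X, ‖x‖ ≤ M) ∧
    ∀ (p : ℕ) (z : Fin p → 𝕜) (x : Fin p → E), Function.Injective x →
      (∀ n, x n ∈ X) → ∑ n, ‖z n‖ ≤ K * ‖∑ n, z n • x n‖

variable (A : Type u) [NonUnitalNormedRing A] [NormedSpace 𝕜 A]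
  [IsScalarTower 𝕜 A A] [SMulCommClass 𝕜 A A]

/-- The right action of `A` on `A*`:  `(fφ)(ψ) = f(φψ)`. -/
def lAct (f : A →L[𝕜] 𝕜) (φ : A) : A →L[𝕜] 𝕜 :=
  f.comp (ContinuousLinearMap.mul 𝕜 A φ)

/-- A functional `f ∈ A*` is weakly almost periodic when its left orbit
`{fφ : ‖φ‖ ≤ 1}` is relatively compact in the weak topology `σ(A*, A**)`. -/
def IsWAP (f : A →L[𝕜] 𝕜) : Prop :=
  IsCompact (closure ((toWeakSpace 𝕜 (A →L[𝕜] 𝕜)) ''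
    {g | ∃ φ : A, ‖φ‖ ≤ 1 ∧ g = lAct 𝕜 A f φ}))

/-- `W(A)`: the closed linear subspace of `A*` spanned by the weakly almost periodic
functionals. -/
def WAP : Submodule 𝕜 (A →L[𝕜] 𝕜) :=
  (Submodule.span 𝕜 {f | IsWAP 𝕜 A f}).topologicalClosure

instance WAP_isClosed : IsClosed ((WAP 𝕜 A : Submodule 𝕜 (A →L[𝕜] 𝕜)) : Set (A →L[𝕜] 𝕜)) :=
  Submodule.isClosed_topologicalClosure _

/-- A Banach algebra is extremely non-Arens regular when `A*/W(A)` contains a closed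
subspace which has `A*` as a quotient (i.e. admits a bounded linear surjection onto `A*`). -/
def ExtremelyNonArensRegular : Prop :=
  ∃ S : Submodule 𝕜 ((A →L[𝕜] 𝕜) ⧸ WAP 𝕜 A),
    IsClosed (S : Set ((A →L[𝕜] 𝕜) ⧸ WAP 𝕜 A)) ∧
    ∃ T : ↥S →L[𝕜] (A →L[𝕜] 𝕜), Function.Surjective T

end Paper

namespace Paper

open Cardinal in
/-- A family of sets, each at least as large as the index type, has an injective
choice function. -/
theorem exists_injective_choice {I X : Type u} (s : I → Set X) (hs : ∀ i, #I ≤ #(s i)) :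
    ∃ g : I → X, Function.Injective g ∧ ∀ i, g i ∈ s i := by
  classical
  obtain ⟨r, hwo, hr⟩ := Cardinal.exists_ord_eq I
  have hex : ∀ (i : I) (F : ∀ j, r j i → X), ∃ x ∈ s i, ∀ j h, F j h ≠ x := by
    intro i F
    by_contra! hcon
    have hsub : s i ⊆ Set.range (fun j : {j // r j i} => F j.1 j.2) := by
      intro x hx
      obtain ⟨j, h, hj⟩ := hcon x hx
      exact ⟨⟨j, h⟩, hj⟩
    have h1 : #(s i) ≤ #{j // r j i} := (mk_le_mk_of_subset hsub).trans mk_range_le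
    have h2 : #{j // r j i} < #I := card_typein_lt i hr
    exact absurd ((hs i).trans h1) (not_le.2 h2)
  choose G hGs hGne using hex
  have hwf : WellFounded r := hwo.wf
  have hfix : ∀ i, hwf.fix G i = G i (fun j _ => hwf.fix G j) := fun i => hwf.fix_eq G i
  refine ⟨hwf.fix G, ?_, fun i => by rw [hfix]; exact hGs _ _⟩
  have hlt : ∀ i j, r j i → hwf.fix G j ≠ hwf.fix G i := fun i j hji => by
    rw [hfix i]
    exact hGne i (fun j _ => hwf.fix G j) j hji
  intro i j hij
  rcases trichotomous_of r i j with h | h | h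
  · exact absurd hij (hlt j i h)
  · exact h
  · exact absurd hij.symm (hlt i j h)

open Cardinal in
/-- A directed set all of whose strict upper sections are as large as itself splits off as many
pairwise disjoint cofinal subsets as it has elements. -/
theorem exists_disjoint_cofinal {Λ J : Type u} [Preorder Λ] {η : Cardinal.{u}}
    (hη : ℵ₀ ≤ η) (hΛ : #Λ ≤ η) (hJ : #J ≤ η) (htr : η ≤ trueCard Λ) :
    ∃ S : J → Set Λ, Pairwise (fun i j => Disjoint (S i) (S j)) ∧ ∀ j, Cofinal (S j) := by
  have hs : ∀ p : Λ × J, #(Λ × J) ≤ #{α : Λ | p.1 < α} := fun p => by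
    refine le_trans ?_ (htr.trans (ciInf_le' _ p.1))
    rw [mk_prod, lift_id, lift_id]
    exact (mul_le_mul' hΛ hJ).trans_eq (mul_eq_self hη)
  obtain ⟨g, hg, hgs⟩ := exists_injective_choice _ hs
  refine ⟨fun j => Set.range fun ξ => g (ξ, j), ?_, fun j ξ =>
    ⟨g (ξ, j), ⟨ξ, rfl⟩, (hgs (ξ, j)).le⟩⟩
  intro i j hij
  refine Set.disjoint_left.2 ?_
  rintro _ ⟨ξ, rfl⟩ ⟨ζ, h⟩
  exact hij (congrArg Prod.snd (hg h)).symm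

section Normed

variable {𝕜 : Type u} [RCLike 𝕜] {E : Type u} [NormedAddCommGroup E] [NormedSpace 𝕜 E]
  {Λ : Type u}

/-- The `ℓ¹`-base inequality for finitely supported combinations of an injective family. -/
theorem IsL1Base.sum_norm_le {η : Cardinal.{u}} {K : ℝ} {a : Λ → E}
    (hbase : IsL1Base 𝕜 η K (Set.range a)) (hinj : Function.Injective a) (l : Λ →₀ 𝕜) :
    ∑ α ∈ l.support, ‖l α‖ ≤ K * ‖Finsupp.linearCombination 𝕜 a l‖ := by
  let e := l.support.equivFin.symm
  have h := hbase.2.2 _ (fun n => l (e n)) (fun n => a (e n))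
    (hinj.comp (Subtype.val_injective.comp e.injective)) (fun n => ⟨_, rfl⟩)
  rw [Equiv.sum_comp e (fun x => ‖l x‖), Equiv.sum_comp e (fun x => l x • a x),
    Finset.sum_coe_sort l.support (fun x => ‖l x‖),
    Finset.sum_coe_sort l.support (fun x => l x • a x)] at h
  rwa [Finsupp.linearCombination_apply, Finsupp.sum]

/-- Bounded scalar families are interpolated by continuous functionals along an `ℓ¹`-base. -/
theorem IsL1Base.exists_dual_apply_eq {η : Cardinal.{u}} {K : ℝ} {a : Λ → E}
    (hbase : IsL1Base 𝕜 η K (Set.range a)) (hinj : Function.Injective a)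
    (x : Λ → 𝕜) {C : ℝ} (hx : ∀ α, ‖x α‖ ≤ C) : ∃ f : E →L[𝕜] 𝕜, ∀ α, f (a α) = x α := by
  rcases isEmpty_or_nonempty Λ with hΛ | ⟨⟨α₀⟩⟩
  · exact ⟨0, fun α => isEmptyElim α⟩
  have hC : 0 ≤ C := (norm_nonneg _).trans (hx α₀)
  have hli : LinearIndependent 𝕜 a := by
    rw [linearIndependent_iff]
    intro l hl
    have h := hbase.sum_norm_le hinj l
    rw [hl, norm_zero, mul_zero] at h
    ext α
    by_contra hα
    have := Finset.single_le_sum (f := fun α => ‖l α‖) (fun _ _ => norm_nonneg _)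
      (Finsupp.mem_support_iff.2 hα)
    exact hα (norm_le_zero_iff.1 (this.trans h))
  let g : Submodule.span 𝕜 (Set.range a) →ₗ[𝕜] 𝕜 :=
    (Finsupp.linearCombination 𝕜 x).comp hli.repr
  have hg : ∀ y, ‖g y‖ ≤ (C * K) * ‖y‖ := by
    intro y
    have h := hbase.sum_norm_le hinj (hli.repr y)
    rw [hli.linearCombination_repr] at h
    calc ‖g y‖ = ‖∑ α ∈ (hli.repr y).support, hli.repr y α • x α‖ := by
          simp [g, Finsupp.linearCombination_apply, Finsupp.sum]
      _ ≤ ∑ α ∈ (hli.repr y).support, C * ‖hli.repr y α‖ := by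
          refine norm_sum_le_of_le _ fun α _ => ?_
          rw [norm_smul, mul_comm]
          exact mul_le_mul_of_nonneg_right (hx α) (norm_nonneg _)
      _ ≤ (C * K) * ‖y‖ := by
          rw [← Finset.mul_sum, mul_assoc]
          exact mul_le_mul_of_nonneg_left h hC
  obtain ⟨f, hf, -⟩ := exists_extension_norm_eq _ (g.mkContinuous _ hg)
  refine ⟨f, fun α => ?_⟩
  have hα : a α ∈ Submodule.span 𝕜 (Set.range a) := Submodule.subset_span ⟨α, rfl⟩
  have h := hf ⟨a α, hα⟩
  rw [LinearMap.mkContinuous_apply] at h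
  rw [h]
  simp [g, hli.repr_eq_single α ⟨a α, hα⟩ rfl]

/-- Evaluation of functionals along an ultrafilter on a bounded family. -/
theorem exists_ultrafilter_limit (U : Ultrafilter Λ) {a : Λ → E} {M : ℝ} (ha : ∀ α, ‖a α‖ ≤ M) :
    ∃ Φ : (E →L[𝕜] 𝕜) →L[𝕜] 𝕜, ∀ f, Tendsto (fun α => f (a α)) U (𝓝 (Φ f)) := by
  have hb : ∀ (f : E →L[𝕜] 𝕜) α, ‖f (a α)‖ ≤ M * ‖f‖ := fun f α =>
    (f.le_opNorm _).trans (by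
      rw [mul_comm]; exact mul_le_mul_of_nonneg_right (ha α) (norm_nonneg _))
  have hex : ∀ f : E →L[𝕜] 𝕜, ∃ l : 𝕜, Tendsto (fun α => f (a α)) U (𝓝 l) := by
    intro f
    obtain ⟨l, -, hl⟩ := (isCompact_closedBall (0 : 𝕜) (M * ‖f‖)).ultrafilter_le_nhds
      (U.map fun α => f (a α)) (by
        rw [Ultrafilter.coe_map, le_principal_iff, mem_map]
        exact Filter.univ_mem' fun α => by simpa using hb f α)
    exact ⟨l, hl⟩
  choose Φ hΦ using hex
  let Φl : (E →L[𝕜] 𝕜) →ₗ[𝕜] 𝕜 :=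
    { toFun := Φ
      map_add' := fun f g => tendsto_nhds_unique (hΦ (f + g)) ((hΦ f).add (hΦ g))
      map_smul' := fun c f => tendsto_nhds_unique (hΦ (c • f)) ((hΦ f).const_smul c) }
  exact ⟨Φl.mkContinuous M fun f => le_of_tendsto (hΦ f).norm (Eventually.of_forall (hb f)), hΦ⟩

end Normed

/-- The dual of a space with a dense subset of cardinality at most `#ι` embeds isometrically in
`ℓ∞(ι)`. -/
theorem exists_dual_linearIsometry_lp {𝕜 E ι : Type u} [RCLike 𝕜] [NormedAddCommGroup E]
    [NormedSpace 𝕜 E] [Nonempty ι] (h : densityChar E ≤ Cardinal.mk ι) :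
    Nonempty ((E →L[𝕜] 𝕜) →ₗᵢ[𝕜] lp (fun _ : ι => 𝕜) ∞) := by
  have : Nonempty {s : Set E // Dense s} := ⟨⟨Set.univ, dense_univ⟩⟩
  obtain ⟨⟨D, hD⟩, hDc⟩ := ciInf_mem fun s : {s : Set E // Dense s} => Cardinal.mk ↥(s.1)
  have hle : Cardinal.mk D ≤ Cardinal.mk ι := hDc.trans_le h
  obtain ⟨emb⟩ := hle
  have : Nonempty D := hD.nonempty.to_subtype
  let d : ι → E := fun i => (Function.invFun emb i : D).1
  have hd : ∀ x ∈ D, ∃ i, d i = x := fun x hx =>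
    ⟨emb ⟨x, hx⟩, congrArg Subtype.val (Function.leftInverse_invFun emb.injective ⟨x, hx⟩)⟩
  let e : ι → E := fun i => ((‖d i‖⁻¹ : ℝ) : 𝕜) • d i
  have he : ∀ i, ‖e i‖ ≤ 1 := fun i => by
    simp only [e, norm_smul, RCLike.norm_ofReal, abs_inv, abs_norm]
    exact inv_mul_le_one
  have hfe : ∀ (f : E →L[𝕜] 𝕜) i, ‖f (e i)‖ ≤ ‖f‖ := fun f i => f.unit_le_opNorm _ (he i)
  let J : (E →L[𝕜] 𝕜) →ₗ[𝕜] lp (fun _ : ι => 𝕜) ∞ :=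
    { toFun := fun f => ⟨fun i => f (e i), memℓp_infty ⟨‖f‖, by rintro _ ⟨i, rfl⟩; exact hfe f i⟩⟩
      map_add' := fun f g => rfl
      map_smul' := fun c f => rfl }
  refine ⟨⟨J, fun f => le_antisymm (lp.norm_le_of_forall_le (norm_nonneg _) (hfe f)) ?_⟩⟩
  refine f.opNorm_le_bound (norm_nonneg _) fun x => ?_
  have hcl : IsClosed {x : E | ‖f x‖ ≤ ‖J f‖ * ‖x‖} :=
    isClosed_le (by fun_prop) (by fun_prop)
  refine (hcl.closure_subset_iff.2 ?_ : closure D ⊆ _) (hD x)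
  intro y hy
  obtain ⟨i, rfl⟩ := hd y hy
  have h1 : ‖f (e i)‖ ≤ ‖J f‖ := lp.norm_apply_le_norm ENNReal.top_ne_zero (J f) i
  rw [Set.mem_ofPred_eq]
  by_cases h0 : d i = 0
  · simp [h0]
  have hpos : 0 < ‖d i‖ := norm_pos_iff.2 h0
  have h2 : ‖f (e i)‖ = ‖d i‖⁻¹ * ‖f (d i)‖ := by
    simp only [e, map_smul, norm_smul, RCLike.norm_ofReal, abs_inv, abs_norm]
  rw [h2, inv_mul_le_iff₀ hpos] at h1
  linarith

section Algebra

variable {𝕜 A : Type u} [RCLike 𝕜] [NonUnitalNormedRing A] [NormedSpace 𝕜 A]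
  [IsScalarTower 𝕜 A A] [SMulCommClass 𝕜 A A]

/-- A weakly almost periodic functional has the same limit along any two ultrafilters finer than
the order filter of a bounded weak TI-net. -/
theorem IsWAP.ultrafilter_limit_eq {Λ : Type u} [Preorder Λ] {a : Λ → A} {M : ℝ}
    (hbdd : ∀ α, ‖a α‖ ≤ M)
    (hTI : ∀ β : Λ,
      Filter.Tendsto (fun α => ‖a α * a β - a α‖) Filter.atTop (nhds 0) ∧
      Filter.Tendsto (fun α => ‖a β * a α - a α‖) Filter.atTop (nhds 0))
    {f : A →L[𝕜] 𝕜} (hf : IsWAP 𝕜 A f) {U V : Ultrafilter Λ}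
    (hU : (U : Filter Λ) ≤ atTop) (hV : (V : Filter Λ) ≤ atTop)
    {Φ Ψ : (A →L[𝕜] 𝕜) →L[𝕜] 𝕜} (hΦ : ∀ f, Tendsto (fun α => f (a α)) U (𝓝 (Φ f)))
    (hΨ : ∀ f, Tendsto (fun α => f (a α)) V (𝓝 (Ψ f))) : Φ f = Ψ f := by
  let R : ℝ := max M 1
  have hR : 0 < R := lt_max_of_lt_right one_pos
  let c : 𝕜 := ((R⁻¹ : ℝ) : 𝕜)
  have hc : c ≠ 0 := by simp [c, hR.ne']
  have hnorm : ∀ α, ‖c • a α‖ ≤ 1 := fun α => by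
    rw [norm_smul, RCLike.norm_ofReal, abs_of_pos (inv_pos.2 hR), inv_mul_le_iff₀ hR, mul_one]
    exact (hbdd α).trans (le_max_left _ _)
  let g : Λ → A →L[𝕜] 𝕜 := fun α => lAct 𝕜 A f (c • a α)
  obtain ⟨w, -, hw⟩ := IsCompact.ultrafilter_le_nhds hf
    (U.map fun α => toWeakSpace 𝕜 (A →L[𝕜] 𝕜) (g α)) (by
      rw [Ultrafilter.coe_map, le_principal_iff, mem_map]
      exact Filter.univ_mem' fun α => subset_closure ⟨g α, ⟨_, hnorm α, rfl⟩, rfl⟩)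
  obtain ⟨h, rfl⟩ := (toWeakSpace 𝕜 (A →L[𝕜] 𝕜)).surjective w
  have hweak : ∀ F : (A →L[𝕜] 𝕜) →L[𝕜] 𝕜, Tendsto (fun α => F (g α)) U (𝓝 (F h)) := fun F =>
    ((WeakBilin.eval_continuous (topDualPairing 𝕜 (A →L[𝕜] 𝕜)).flip F).tendsto
      (toWeakSpace 𝕜 (A →L[𝕜] 𝕜) h)).comp hw
  have hzero : ∀ {l : Filter Λ} {u : Λ → A}, Tendsto (fun α => ‖u α‖) l (𝓝 0) →
      Tendsto (fun α => f (u α)) l (𝓝 0) := fun {l u} hu => by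
    simpa [Function.comp_def] using (f.continuous.tendsto 0).comp
      (tendsto_zero_iff_norm_tendsto_zero.2 hu)
  have hgapp : ∀ α x, g α x = c * f (a α * x) := fun α x => by
    simp [g, lAct]
  have h1 : ∀ β, h (a β) = c * Φ f := fun β => by
    refine tendsto_nhds_unique (hweak (ContinuousLinearMap.apply 𝕜 𝕜 (a β))) ?_
    have := ((hzero ((hTI β).1.mono_left hU)).add (hΦ f)).const_mul c
    simpa [hgapp] using this
  have h2 : ∀ α, Ψ (g α) = c * Ψ f := fun α => by
    refine tendsto_nhds_unique (hΨ (g α)) ?_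
    have := ((hzero ((hTI α).2.mono_left hV)).add (hΨ f)).const_mul c
    simpa [hgapp] using this
  have h3 : Ψ h = c * Φ f := by
    refine tendsto_nhds_unique (hΨ h) ?_
    simp only [h1]
    exact tendsto_const_nhds
  have h4 : Ψ h = c * Ψ f := by
    refine tendsto_nhds_unique (hweak Ψ) ?_
    simp only [h2]
    exact tendsto_const_nhds
  exact mul_left_cancel₀ hc (h3.symm.trans h4)

/-- A continuous linear map vanishing on weakly almost periodic functionals vanishes on `W(A)`. -/
theorem WAP_le_ker {F : Type u} [NormedAddCommGroup F] [NormedSpace 𝕜 F]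
    (T : (A →L[𝕜] 𝕜) →L[𝕜] F) (hT : ∀ f, IsWAP 𝕜 A f → T f = 0) :
    WAP 𝕜 A ≤ LinearMap.ker (T : (A →L[𝕜] 𝕜) →ₗ[𝕜] F) :=
  Submodule.topologicalClosure_minimal _ (Submodule.span_le.2 fun f hf => hT f hf)
    T.isClosed_ker

/-- `A*/W(A)` surjects onto `ℓ∞(η)` when `A` contains a weak TI-net of true cardinality `η`
forming an `ℓ¹(η)`-base: take differences of ultrafilter limits along disjoint cofinal sets. -/
theorem exists_surjective_quotient_WAP {ι Λ : Type u} [Preorder Λ] [Nonempty Λ]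
    [IsDirected Λ (· ≤ ·)] {η : Cardinal.{u}} (hη : Cardinal.aleph0 ≤ η)
    (hι : Cardinal.mk ι = η) (htr : trueCard Λ = η)
    {a : Λ → A} (hainj : Function.Injective a) {M : ℝ} (hbdd : ∀ α, ‖a α‖ ≤ M)
    (hTI : ∀ β : Λ,
      Filter.Tendsto (fun α => ‖a α * a β - a α‖) Filter.atTop (nhds 0) ∧
      Filter.Tendsto (fun α => ‖a β * a α - a α‖) Filter.atTop (nhds 0))
    {K : ℝ} (hbase : IsL1Base 𝕜 η K (Set.range a)) :
    ∃ T : ((A →L[𝕜] 𝕜) ⧸ WAP 𝕜 A) →L[𝕜] lp (fun _ : ι => 𝕜) ∞, Function.Surjective T := by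
  classical
  have hΛ : Cardinal.mk Λ = η := by rw [← hbase.1, Cardinal.mk_range_eq a hainj]
  have hJ : Cardinal.mk (Option ι) ≤ η := by
    rw [Cardinal.mk_option, hι]
    exact (Cardinal.add_one_eq hη).le
  obtain ⟨S, hSd, hSc⟩ := exists_disjoint_cofinal hη hΛ.le hJ htr.ge
  have hne : ∀ j, (atTop ⊓ 𝓟 (S j)).NeBot := fun j => by
    rw [← frequently_mem_iff_neBot, frequently_atTop]
    intro ξ
    obtain ⟨α, hα, h⟩ := hSc j ξ
    exact ⟨α, h, hα⟩
  let U : Option ι → Ultrafilter Λ := fun j => Ultrafilter.of (atTop ⊓ 𝓟 (S j))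
  have hU : ∀ j, (U j : Filter Λ) ≤ atTop := fun j => (Ultrafilter.of_le _).trans inf_le_left
  have hUS : ∀ j, ∀ᶠ α in (U j : Filter Λ), α ∈ S j := fun j =>
    le_principal_iff.1 ((Ultrafilter.of_le _).trans inf_le_right)
  choose Φ hΦ using fun j => exists_ultrafilter_limit (𝕜 := 𝕜) (U j) hbdd
  have hb : ∀ j f, ‖Φ j f‖ ≤ M * ‖f‖ := fun j f =>
    le_of_tendsto (hΦ j f).norm (Eventually.of_forall fun α => (f.le_opNorm _).trans (by
      rw [mul_comm]; exact mul_le_mul_of_nonneg_right (hbdd α) (norm_nonneg _)))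
  have hb2 : ∀ i f, ‖Φ (some i) f - Φ none f‖ ≤ (M + M) * ‖f‖ := fun i f => by
    rw [add_mul]
    exact (norm_sub_le _ _).trans (add_le_add (hb _ f) (hb _ f))
  have hM : 0 ≤ M := (norm_nonneg _).trans (hbdd (Classical.arbitrary Λ))
  let T₀ : (A →L[𝕜] 𝕜) →ₗ[𝕜] lp (fun _ : ι => 𝕜) ∞ :=
    { toFun := fun f => ⟨fun i => Φ (some i) f - Φ none f,
        memℓp_infty ⟨(M + M) * ‖f‖, by rintro _ ⟨i, rfl⟩; exact hb2 i f⟩⟩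
      map_add' := fun f g => by
        ext i
        change Φ (some i) (f + g) - Φ none (f + g) =
          (Φ (some i) f - Φ none f) + (Φ (some i) g - Φ none g)
        rw [map_add, map_add]
        ring
      map_smul' := fun c f => by
        ext i
        change Φ (some i) (c • f) - Φ none (c • f) = c • (Φ (some i) f - Φ none f)
        rw [map_smul, map_smul, smul_sub] }
  let T : (A →L[𝕜] 𝕜) →L[𝕜] lp (fun _ : ι => 𝕜) ∞ := T₀.mkContinuous (M + M) fun f =>
    lp.norm_le_of_forall_le (by positivity) fun i => hb2 i f
  have hTapp : ∀ f i, T f i = Φ (some i) f - Φ none f := fun f i => rfl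
  have hTW : ∀ f, IsWAP 𝕜 A f → T f = 0 := fun f hf => by
    ext i
    rw [hTapp, hf.ultrafilter_limit_eq hbdd hTI (hU _) (hU _) (hΦ (some i)) (hΦ none), sub_self]
    rfl
  refine ⟨(WAP 𝕜 A).liftQL T (WAP_le_ker T hTW), fun z => ?_⟩
  let x : Λ → 𝕜 := fun α => if h : ∃ i, α ∈ S (some i) then z h.choose else 0
  have hx : ∀ α, ‖x α‖ ≤ ‖z‖ := fun α => by
    by_cases h : ∃ i, α ∈ S (some i)
    · simp only [x, dif_pos h]
      exact lp.norm_apply_le_norm ENNReal.top_ne_zero z _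
    · simp [x, dif_neg h]
  have huniq : ∀ {α j j'}, α ∈ S j → α ∈ S j' → j = j' := fun {α j j'} h h' => by
    by_contra hjj
    exact Set.disjoint_left.1 (hSd hjj) h h'
  have hxs : ∀ i, ∀ α ∈ S (some i), x α = z i := fun i α hα => by
    have h : ∃ i, α ∈ S (some i) := ⟨i, hα⟩
    simp only [x, dif_pos h]
    rw [Option.some_injective _ (huniq h.choose_spec hα)]
  have hxn : ∀ α ∈ S none, x α = 0 := fun α hα => by
    have h : ¬ ∃ i, α ∈ S (some i) := fun ⟨i, hi⟩ => Option.some_ne_none i (huniq hi hα)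
    simp only [x, dif_neg h]
  obtain ⟨f, hf⟩ := hbase.exists_dual_apply_eq hainj x hx
  have hlim : ∀ j c, (∀ α ∈ S j, x α = c) → Φ j f = c := fun j c hc =>
    tendsto_nhds_unique (hΦ j f) (tendsto_const_nhds.congr' ((hUS j).mono fun α hα => by
      simp only [hf, hc α hα]))
  refine ⟨Submodule.Quotient.mk f, ?_⟩
  change T f = z
  ext i
  rw [hTapp, hlim _ _ (hxs i), hlim _ _ hxn, sub_zero]

/-- A Banach algebra is extremely non-Arens regular once `A*/W(A)` surjects onto an `ℓ∞`-space
large enough to contain `A*`. -/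
theorem ExtremelyNonArensRegular.of_surjective {ι : Type u} [Nonempty ι]
    (hd : densityChar A ≤ Cardinal.mk ι)
    {T : ((A →L[𝕜] 𝕜) ⧸ WAP 𝕜 A) →L[𝕜] lp (fun _ : ι => 𝕜) ∞} (hT : Function.Surjective T) :
    ExtremelyNonArensRegular 𝕜 A := by
  obtain ⟨J⟩ := exists_dual_linearIsometry_lp (𝕜 := 𝕜) hd
  have hcl : IsClosed (J.toLinearMap.range : Set (lp (fun _ : ι => 𝕜) ∞)) :=
    J.isometry.isClosedEmbedding.isClosed_range
  let S := J.toLinearMap.range.comap (T : ((A →L[𝕜] 𝕜) ⧸ WAP 𝕜 A) →ₗ[𝕜] _)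
  refine ⟨S, hcl.preimage T.continuous, ?_⟩
  let T₁ : S →L[𝕜] J.toLinearMap.range := (T.comp S.subtypeL).codRestrict _ fun s => s.2
  refine ⟨(J.equivRange.symm.toContinuousLinearEquiv : _ →L[𝕜] _).comp T₁, ?_⟩
  refine J.equivRange.symm.surjective.comp fun y => ?_
  obtain ⟨q, hq⟩ := hT y
  exact ⟨⟨q, show T q ∈ _ from hq ▸ y.2⟩, Subtype.ext hq⟩

end Algebra

/-- if a Banach algebra `A` contains a weak TI-net, indexed injectively
by a directed set of true cardinality `η`, which is an `ℓ¹(η)`-base, then (i) there is a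
bounded linear surjection of `A*/W(A)` onto `ℓ∞(η)`; (ii) in particular `A` is not Arens
regular; and (iii) if `d(A) = η` then `A` is extremely non-Arens regular. -/
theorem statement10 (𝕜 A : Type u) [RCLike 𝕜] [NonUnitalNormedRing A] [NormedSpace 𝕜 A]
    [IsScalarTower 𝕜 A A] [SMulCommClass 𝕜 A A] [CompleteSpace A]
    (η : Cardinal.{u}) (hη : Cardinal.aleph0 ≤ η)
    (ι : Type u) (hι : Cardinal.mk ι = η)
    (Λ : Type u) [Preorder Λ] [Nonempty Λ] [IsDirected Λ (· ≤ ·)]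
    (htr : trueCard Λ = η)
    (a : Λ → A) (hainj : Function.Injective a)
    -- `{a_α}` is a bounded weak TI-net
    (M : ℝ) (hbdd : ∀ α, ‖a α‖ ≤ M)
    (hTI : ∀ β : Λ,
      Filter.Tendsto (fun α => ‖a α * a β - a α‖) Filter.atTop (nhds 0) ∧
      Filter.Tendsto (fun α => ‖a β * a α - a α‖) Filter.atTop (nhds 0))
    -- which is an `ℓ¹(η)`-base
    (K : ℝ) (hK : 0 < K) (hbase : IsL1Base 𝕜 η K (Set.range a)) :
    (∃ T : ((A →L[𝕜] 𝕜) ⧸ WAP 𝕜 A) →L[𝕜] lp (fun _ : ι => 𝕜) ∞, Function.Surjective T) ∧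
    WAP 𝕜 A ≠ ⊤ ∧
    (densityChar A = η → ExtremelyNonArensRegular 𝕜 A) := by
  have : Nonempty ι := Cardinal.mk_ne_zero_iff.1
    (hι ▸ (Cardinal.aleph0_pos.trans_le hη).ne')
  obtain ⟨T, hT⟩ := exists_surjective_quotient_WAP hη hι htr hainj hbdd hTI hbase
  refine ⟨⟨T, hT⟩, fun htop => ?_, fun hd => .of_surjective (hd.trans hι.symm).le hT⟩
  have : Subsingleton ((A →L[𝕜] 𝕜) ⧸ WAP 𝕜 A) := Submodule.Quotient.subsingleton_iff.2 htop
  obtain ⟨q, hq⟩ := hT ⟨fun _ => 1, one_memℓp_infty⟩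
  rw [Subsingleton.elim q 0, map_zero] at hq
  exact zero_ne_one (congrArg (fun z : lp (fun _ : ι => 𝕜) ∞ => z (Classical.arbitrary ι)) hq)

end Paper
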